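/- arXiv:2111.01262 — 3 statements merged into one kernel-verified Lean document; each statement's English description precedes it below -/
import Mathlib

section
/- (Extra-Gradient Replacement-Greedy convergence.) Let V be a finite set, k ≥ 2 an integer, and fix constants H, G, a, b, A ≥ 0. Then there exists a constant K ≥ 0, depending only on H, G, a, b, A, and k (and not on T), with the following property. Let X ⊆ ℝ^d be nonempty, closed, and convex with x₁ ∈ X and ‖x − x₁‖² ≤ H for all x ∈ X; let f : ℝ^d × 2^V → [0, ∞) be such that for every S ⊆ V with |S| ≤ k the map f(·, S) is convex and differentiable, ‖∇ₓ f(x, S)‖ ≤ G for all x, ‖∇ₓ f(x', S') − ∇ₓ f(x, S)‖ ≤ a‖x' − x‖ + b for all x, x' and all |S|, |S'| ≤ k, and f(x₁, S) ≤ A for all |S| ≤ k. Let T be a positive integer, γ = 1/√T, γ·a ≤ 3/4, and suppose iterates satisfy for all 1 ≤ t ≤ T: x̂_t = π_X(x_t − γ ∇ₓ f(x_t, S_t)); f(x_t, Ŝ_t) − f(x_t, S_t) ≥ (1/k)( f(x_t, S) − 2 f(x_t, S_t) ) for all |S| ≤ k; x_{t+1} = π_X(x_t − γ ∇ₓ f(x̂_t,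 Ŝ_t)); f(x̂_t, S_{t+1}) − f(x̂_t, Ŝ_t) ≥ (1/k)( f(x̂_t, S) − 2 f(x̂_t, Ŝ_t) ) for all |S| ≤ k; with |S_t| ≤ k, |Ŝ_t| ≤ k throughout. Then, with x̄ = (1/T) ∑_{t=1}^T x̂_t: (1/2) · max_{|S| ≤ k} f(x̄, S) ≤ min_{x ∈ X} max_{|S| ≤ k} f(x, S) + K/√T. -/
open scoped RealInnerProductSpace

/-- `maxCard k g` is the maximum of `g S` over all `S ⊆ V` with `|S| ≤ k`. -/
noncomputable def maxCard {V : Type} [Fintype V] [DecidableEq V] (k : ℕ)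
    (g : Finset V → ℝ) : ℝ :=
  ((Finset.univ : Finset (Finset V)).filter (fun S => S.card ≤ k)).sup'
    ⟨∅, by simp⟩ g

section Helpers

variable {E : Type*} [NormedAddCommGroup E] [InnerProductSpace ℝ E]

/-- First-order lower bound for a convex function. -/
theorem ConvexOn.add_inner_gradient_le [CompleteSpace E] {φ : E → ℝ}
    (hφ : ConvexOn ℝ Set.univ φ) {x g : E} (hg : HasGradientAt φ g x) (y : E) :
    φ x + ⟪g, y - x⟫ ≤ φ y := by
  have hconv : ConvexOn ℝ Set.univ (fun r : ℝ => φ (AffineMap.lineMap x y r)) := by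
    simpa [Function.comp_def] using hφ.comp_affineMap (AffineMap.lineMap x y : ℝ →ᵃ[ℝ] E)
  have hderiv : HasDerivAt (fun r : ℝ => φ (AffineMap.lineMap x y r)) ⟪g, y - x⟫ 0 := by
    have hg' : HasFDerivAt φ ((InnerProductSpace.toDual ℝ E) g)
        (AffineMap.lineMap x y (0 : ℝ)) := by
      simpa using hg.hasFDerivAt
    simpa [Function.comp_def] using
      hg'.comp_hasDerivAt (0 : ℝ) (AffineMap.hasDerivAt_lineMap (a := x) (b := y))
  have h := hconv.le_slope_of_hasDerivAt (Set.mem_univ 0) (Set.mem_univ 1) one_pos hderiv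
  simp [slope_def_field] at h
  linarith

theorem ConvexOn.abs_sub_le_of_gradient_norm_le [CompleteSpace E] {φ : E → ℝ}
    (hφ : ConvexOn ℝ Set.univ φ) {g : E → E} (hg : ∀ x, HasGradientAt φ (g x) x) {G : ℝ}
    (hG : ∀ x, ‖g x‖ ≤ G) (x y : E) : |φ y - φ x| ≤ G * ‖y - x‖ := by
  have key : ∀ u v : E, φ u - φ v ≤ G * ‖v - u‖ := fun u v => by
    have h₁ := hφ.add_inner_gradient_le (hg u) v
    have h₂ := (abs_le.1 (abs_real_inner_le_norm (g u) (v - u))).1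
    have h₃ := mul_le_mul_of_nonneg_right (hG u) (norm_nonneg (v - u))
    linarith
  refine abs_sub_le_iff.2 ⟨?_, key x y⟩
  rw [norm_sub_rev]
  exact key y x

/-- Nonexpansiveness of the metric projection, in variational form. -/
theorem norm_sub_le_of_projections {X : Set E} {u v p q : E} (hp : p ∈ X) (hq : q ∈ X)
    (hup : ∀ w ∈ X, ⟪u - p, w - p⟫ ≤ 0) (hvq : ∀ w ∈ X, ⟪v - q, w - q⟫ ≤ 0) :
    ‖p - q‖ ≤ ‖u - v‖ := by
  have h₁ := hup q hq
  have h₂ := hvq p hp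
  have h₃ : ⟪u - p, q - p⟫ + ⟪v - q, p - q⟫ = ‖p - q‖ ^ 2 - ⟪u - v, p - q⟫ := by
    rw [← real_inner_self_eq_norm_sq]
    simp only [inner_sub_left, inner_sub_right]
    ring
  have h₄ := real_inner_le_norm (u - v) (p - q)
  by_contra! h
  nlinarith [norm_nonneg (u - v), norm_nonneg (p - q)]

/-- The distance decrease of one projected gradient step. -/
theorem inner_projected_step_le {x p g w : E} {γ : ℝ}
    (h : ⟪(x - γ • g) - p, w - p⟫ ≤ 0) :
    γ * ⟪g, p - w⟫ ≤ (‖x - w‖ ^ 2 - ‖p - w‖ ^ 2) / 2 := by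
  have h₁ : ‖x - w‖ ^ 2 = ‖x - p‖ ^ 2 + 2 * ⟪x - p, p - w⟫ + ‖p - w‖ ^ 2 := by
    rw [← norm_add_sq_real, sub_add_sub_cancel]
  have h₂ : ⟪(x - γ • g) - p, w - p⟫ = γ * ⟪g, p - w⟫ - ⟪x - p, p - w⟫ := by
    simp only [inner_sub_left, inner_sub_right, real_inner_smul_left]
    ring
  nlinarith [sq_nonneg ‖x - p‖]

theorem sum_Icc_le_of_le_potential_sub {u Φ : ℕ → ℝ} {c : ℝ} {T : ℕ}
    (h : ∀ t, 1 ≤ t → t ≤ T → u t ≤ Φ t - Φ (t + 1) + c) :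
    ∑ t ∈ Finset.Icc 1 T, u t ≤ Φ 1 - Φ (T + 1) + T * c := by
  induction T with
  | zero => simp
  | succ n ih =>
    rw [Finset.sum_Icc_succ_top (by omega)]
    have h₁ := ih fun t h₁ h₂ => h t h₁ (by omega)
    have h₂ := h (n + 1) (by omega) le_rfl
    push_cast
    linarith

theorem le_maxCard {V : Type} [Fintype V] [DecidableEq V] {k : ℕ} (g : Finset V → ℝ)
    {S : Finset V} (hS : S.card ≤ k) : g S ≤ maxCard k g :=
  Finset.le_sup' g (by simpa using hS)

theorem exists_maxCard_eq {V : Type} [Fintype V] [DecidableEq V] (k : ℕ)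
    (g : Finset V → ℝ) : ∃ S : Finset V, S.card ≤ k ∧ maxCard k g = g S := by
  obtain ⟨S, hS, h⟩ := Finset.exists_mem_eq_sup'
    (s := (Finset.univ : Finset (Finset V)).filter (fun S => S.card ≤ k)) ⟨∅, by simp⟩ g
  exact ⟨S, by simpa using hS, h⟩

end Helpers

/-- (Extra-Gradient Replacement-Greedy convergence.) For a
finite set `V`, `k ≥ 2`, and constants `H, G, a, b, A ≥ 0`, there is a constant
`K ≥ 0` (independent of `T`) such that for any instance satisfying the stated
hypotheses and the EGRG iterate conditions with step `γ = 1/√T`, `γa ≤ 3/4`,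
the averaged auxiliary iterate `x̄ = (1/T)∑ x̂_t` satisfies
`(1/2)·max_{|S|≤k} f(x̄,S) ≤ min_{x∈X} max_{|S|≤k} f(x,S) + K/√T`. -/
theorem extra_gradient_replacement_greedy_convergence
    (V : Type) [Fintype V] [DecidableEq V] (k : ℕ) (hk : 2 ≤ k)
    (H G a b A : ℝ) (hH : 0 ≤ H) (hG : 0 ≤ G) (ha : 0 ≤ a) (hb : 0 ≤ b)
    (hA : 0 ≤ A) :
    ∃ K : ℝ, 0 ≤ K ∧
      ∀ (d : ℕ)
        (X : Set (EuclideanSpace ℝ (Fin d))), X.Nonempty → IsClosed X →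
        Convex ℝ X →
      ∀ (f : EuclideanSpace ℝ (Fin d) → Finset V → ℝ)
        (gradf : EuclideanSpace ℝ (Fin d) → Finset V →
          EuclideanSpace ℝ (Fin d)),
        (∀ x S, 0 ≤ f x S) →
        (∀ S : Finset V, S.card ≤ k → ConvexOn ℝ Set.univ (fun x => f x S)) →
        (∀ S : Finset V, S.card ≤ k →
          ∀ x, HasGradientAt (fun y => f y S) (gradf x S) x) →
        (∀ x, ∀ S : Finset V, S.card ≤ k → ‖gradf x S‖ ≤ G) →
        (∀ x x' : EuclideanSpace ℝ (Fin d), ∀ S S' : Finset V,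
          S.card ≤ k → S'.card ≤ k →
          ‖gradf x' S' - gradf x S‖ ≤ a * ‖x' - x‖ + b) →
      ∀ (T : ℕ), 0 < T →
      ∀ (γ : ℝ), γ = 1 / Real.sqrt T → γ * a ≤ 3 / 4 →
      ∀ (x xhat : ℕ → EuclideanSpace ℝ (Fin d)) (S Shat : ℕ → Finset V),
        x 1 ∈ X →
        (∀ z ∈ X, ‖z - x 1‖ ^ 2 ≤ H) →
        (∀ S' : Finset V, S'.card ≤ k → f (x 1) S' ≤ A) →
        (∀ t, 1 ≤ t → t ≤ T + 1 → (S t).card ≤ k) →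
        (∀ t, 1 ≤ t → t ≤ T → (Shat t).card ≤ k) →
        (∀ t, 1 ≤ t → t ≤ T → xhat t ∈ X) →
        (∀ t, 1 ≤ t → t ≤ T → ∀ w ∈ X,
          ⟪(x t - γ • gradf (x t) (S t)) - xhat t, w - xhat t⟫ ≤ 0) →
        (∀ t, 1 ≤ t → t ≤ T → ∀ S' : Finset V, S'.card ≤ k →
          (1 / (k : ℝ)) * (f (x t) S' - 2 * f (x t) (S t)) ≤
            f (x t) (Shat t) - f (x t) (S t)) →
        (∀ t, 1 ≤ t → t ≤ T → x (t + 1) ∈ X) →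
        (∀ t, 1 ≤ t → t ≤ T → ∀ w ∈ X,
          ⟪(x t - γ • gradf (xhat t) (Shat t)) - x (t + 1),
            w - x (t + 1)⟫ ≤ 0) →
        (∀ t, 1 ≤ t → t ≤ T → ∀ S' : Finset V, S'.card ≤ k →
          (1 / (k : ℝ)) * (f (xhat t) S' - 2 * f (xhat t) (Shat t)) ≤
            f (xhat t) (S (t + 1)) - f (xhat t) (Shat t)) →
      ∀ (xbar : EuclideanSpace ℝ (Fin d)),
        xbar = (1 / (T : ℝ)) • ∑ t ∈ Finset.Icc 1 T, xhat t →
        (1 / 2) * maxCard k (f xbar) ≤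
          sInf ((fun z => maxCard k (f z)) '' X) + K / Real.sqrt T := by
  have hk' : (2 : ℝ) ≤ k := by exact_mod_cast hk
  obtain ⟨α, hα⟩ : ∃ α : ℝ, α = 1 - 2 / k := ⟨_, rfl⟩
  have hα0 : 0 ≤ α := by
    rw [hα, sub_nonneg, div_le_one (by linarith)]
    exact hk'
  have hα1 : α < 1 := by
    rw [hα]
    have : (0 : ℝ) < 2 / k := by positivity
    linarith
  obtain ⟨β, hβ⟩ : ∃ β : ℝ, β = 1 - α ^ 2 := ⟨_, rfl⟩
  have hβ0 : 0 < β := by rw [hβ]; nlinarith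
  refine ⟨H / 2 + 2 * G ^ 2 + (2 * A + G * √H + 6 * G ^ 2) / β, by positivity, ?_⟩
  intro d X hXne _ _ f gradf hf0 hconv hgrad hgradG _ T hT γ hγ _ x xhat S Shat hx1 hXH hfA
    hS hShat hxhat hproj_hat hgreedy hx hproj hgreedy_hat xbar hxbar
  have hT' : (0 : ℝ) < T := by exact_mod_cast hT
  obtain ⟨s, hs⟩ : ∃ s : ℝ, s = √(T : ℝ) := ⟨_, rfl⟩
  have hs0 : 0 < s := by rw [hs]; positivity
  have hss : s * s = T := by rw [hs]; exact Real.mul_self_sqrt hT'.le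
  have hs1 : 1 ≤ s := by
    rw [hs]
    exact Real.one_le_sqrt.2 (by exact_mod_cast hT)
  rw [← hs] at hγ ⊢
  have hγs : γ * s = 1 := by rw [hγ]; field_simp
  have hγ0 : 0 < γ := by rw [hγ]; positivity
  have hxX : ∀ t, 1 ≤ t → t ≤ T + 1 → x t ∈ X := fun t h₁ h₂ => by
    obtain rfl | h := h₁.eq_or_lt
    · exact hx1
    · obtain ⟨m, rfl⟩ : ∃ m, t = m + 1 := ⟨t - 1, by omega⟩
      exact hx m (by omega) (by omega)
  have hlip : ∀ S' : Finset V, S'.card ≤ k → ∀ y z, |f z S' - f y S'| ≤ G * ‖z - y‖ :=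
    fun S' h => (hconv S' h).abs_sub_le_of_gradient_norm_le (hgrad S' h) (hgradG · S' h)
  have hdist_hat : ∀ t, 1 ≤ t → t ≤ T → ‖xhat t - x t‖ ≤ γ * G := fun t h₁ h₂ => by
    refine (norm_sub_le_of_projections (v := x t) (hxhat t h₁ h₂) (hxX t h₁ (by omega))
      (hproj_hat t h₁ h₂) (by simp)).trans ?_
    rw [sub_sub_cancel_left, norm_neg, norm_smul, Real.norm_of_nonneg hγ0.le]
    exact mul_le_mul_of_nonneg_left (hgradG _ _ (hS t h₁ (by omega))) hγ0.le
  have hdist : ∀ t, 1 ≤ t → t ≤ T → ‖x (t + 1) - xhat t‖ ≤ 2 * (γ * G) := fun t h₁ h₂ => by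
    refine (norm_sub_le_of_projections (hx t h₁ h₂) (hxhat t h₁ h₂)
      (hproj t h₁ h₂) (hproj_hat t h₁ h₂)).trans ?_
    rw [sub_sub_sub_cancel_left, ← smul_sub, norm_smul, Real.norm_of_nonneg hγ0.le]
    have h₃ := norm_sub_le (gradf (x t) (S t)) (gradf (xhat t) (Shat t))
    have h₄ := hgradG (x t) _ (hS t h₁ (by omega))
    have h₅ := hgradG (xhat t) _ (hShat t h₁ h₂)
    nlinarith
  -- A greedy exchange contracts the deficit with respect to half of any feasible value.
  have hcontract : ∀ p u v : ℝ, 1 / (k : ℝ) * (p - 2 * u) ≤ v - u →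
      α * (u - p / 2) ≤ v - p / 2 := fun p u v h => by
    have h₁ : α * (u - p / 2) = u - p / 2 + 1 / (k : ℝ) * (p - 2 * u) := by
      rw [hα]
      ring
    linarith
  obtain ⟨S', hS', hmax⟩ := exists_maxCard_eq k (f xbar)
  rw [hmax, ← sub_le_iff_le_add]
  refine le_csInf (hXne.image _) ?_
  rintro _ ⟨z, hz, rfl⟩
  rw [sub_le_iff_le_add]
  beta_reduce
  obtain ⟨r, hr⟩ : ∃ r : ℕ → ℝ, ∀ t, r t = f (x t) (S t) - f (x t) S' / 2 :=
    ⟨_, fun _ => rfl⟩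
  obtain ⟨c, hc⟩ : ∃ c : ℝ, c = 3 * (γ * G ^ 2) := ⟨_, rfl⟩
  have hdeficit : ∀ t, 1 ≤ t → t ≤ T →
      α * (r t - r (t + 1)) - 2 * c ≤ β * (f (xhat t) (Shat t) - f (xhat t) S' / 2) := by
    intro t h₁ h₂
    have e₁ := hcontract _ _ _ (hgreedy t h₁ h₂ S' hS')
    have e₂ := hcontract _ _ _ (hgreedy_hat t h₁ h₂ S' hS')
    have d₁ := mul_le_mul_of_nonneg_left (hdist_hat t h₁ h₂) hG
    have d₂ := mul_le_mul_of_nonneg_left (hdist t h₁ h₂) hG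
    have l₁ := abs_le.1 ((hlip _ (hShat t h₁ h₂) (x t) (xhat t)).trans d₁)
    have l₂ := abs_le.1 ((hlip _ hS' (x t) (xhat t)).trans d₁)
    have l₃ := abs_le.1 ((hlip _ (hS (t + 1) (by omega) (by omega)) (xhat t) (x (t + 1))).trans d₂)
    have l₄ := abs_le.1 ((hlip _ hS' (xhat t) (x (t + 1))).trans d₂)
    rw [← hr] at e₁
    have hcG : 0 ≤ γ * G ^ 2 := by positivity
    have hGG : G * (γ * G) = γ * G ^ 2 := by ring
    have m₁ : α * r t - c ≤ f (xhat t) (Shat t) - f (xhat t) S' / 2 := by linarith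
    have m₂ : α * (f (xhat t) (Shat t) - f (xhat t) S' / 2) - c ≤ r (t + 1) := by
      linarith [hr (t + 1)]
    rw [hβ]
    have m₃ := mul_le_mul_of_nonneg_left m₂ hα0
    have m₄ : α * c ≤ c := mul_le_of_le_one_left (by linarith) hα1.le
    linarith
  have hregret : ∀ t, 1 ≤ t → t ≤ T → f (xhat t) (Shat t) - maxCard k (f z) ≤
      s / 2 * (‖x t - z‖ ^ 2 - ‖x (t + 1) - z‖ ^ 2) + 2 * (γ * G ^ 2) := by
    intro t h₁ h₂
    have e₁ := (hconv _ (hShat t h₁ h₂)).add_inner_gradient_le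
      (hgrad _ (hShat t h₁ h₂) (xhat t)) z
    have e₂ := le_maxCard (f z) (hShat t h₁ h₂)
    have e₃ := inner_projected_step_le (hproj t h₁ h₂ z hz)
    have e₄ := (abs_le.1 (abs_real_inner_le_norm (gradf (xhat t) (Shat t))
      (x (t + 1) - xhat t))).1
    have e₅ := mul_le_mul (hgradG (xhat t) _ (hShat t h₁ h₂)) (hdist t h₁ h₂)
      (norm_nonneg _) hG
    have e₆ := mul_le_mul_of_nonneg_left e₃ hs0.le
    rw [← mul_assoc, mul_comm s γ, hγs, one_mul] at e₆
    simp only [inner_sub_right] at e₁ e₄ e₆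
    linarith
  have hsum := sum_Icc_le_of_le_potential_sub (T := T) (u := fun t => f (xhat t) S' / 2)
    (Φ := fun t => s / 2 * ‖x t - z‖ ^ 2 - α / β * r t)
    (c := maxCard k (f z) + 2 * (γ * G ^ 2) + 2 * c / β) fun t h₁ h₂ => by
      have e₁ := hregret t h₁ h₂
      have e₂ := (div_le_iff₀' hβ0).2 (hdeficit t h₁ h₂)
      have e₃ : (α * (r t - r (t + 1)) - 2 * c) / β =
          α / β * r t - α / β * r (t + 1) - 2 * c / β := by ring
      linarith
  have hjensen : f xbar S' ≤ 1 / (T : ℝ) * ∑ t ∈ Finset.Icc 1 T, f (xhat t) S' := by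
    have h := (hconv S' hS').map_sum_le (t := Finset.Icc 1 T) (w := fun _ => 1 / (T : ℝ))
      (p := xhat) (fun _ _ => by positivity) (by simp [hT'.ne']) (fun _ _ => Set.mem_univ _)
    rwa [← Finset.smul_sum, ← hxbar, ← Finset.smul_sum, smul_eq_mul] at h
  have hstart : -(A / 2) ≤ r 1 := by
    linarith [hr 1, hf0 (x 1) (S 1), hfA S' hS']
  have hend : r (T + 1) ≤ A + G * √H := by
    have hST := hS (T + 1) (by omega) le_rfl
    have e₁ := (abs_le.1 (hlip _ hST (x 1) (x (T + 1)))).2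
    have e₂ := mul_le_mul_of_nonneg_left
      (Real.le_sqrt_of_sq_le (hXH _ (hxX (T + 1) (by omega) le_rfl))) hG
    linarith [hr (T + 1), hf0 (x (T + 1)) S', hfA _ hST]
  have hz1 : s / 2 * ‖x 1 - z‖ ^ 2 ≤ s / 2 * H := by
    rw [norm_sub_rev]
    exact mul_le_mul_of_nonneg_left (hXH z hz) (by positivity)
  have hpotential : α / β * (r (T + 1) - r 1) ≤ s * ((2 * A + G * √H) / β) := by
    have e₁ : 0 ≤ (2 * A + G * √H) / β := by positivity
    calc α / β * (r (T + 1) - r 1)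
        ≤ α / β * (2 * A + G * √H) :=
          mul_le_mul_of_nonneg_left (by linarith) (by positivity)
      _ = α * ((2 * A + G * √H) / β) := by ring
      _ ≤ s * ((2 * A + G * √H) / β) :=
          mul_le_mul_of_nonneg_right (by linarith) e₁
  have hTγ : (T : ℝ) * γ = s := by
    rw [← hss]
    linear_combination s * hγs
  have hfinal : ∑ t ∈ Finset.Icc 1 T, f (xhat t) S' / 2 ≤
      T * maxCard k (f z) + s * (H / 2 + 2 * G ^ 2 + (2 * A + G * √H + 6 * G ^ 2) / β) := by
    have e₁ : 0 ≤ s / 2 * ‖x (T + 1) - z‖ ^ 2 := by positivity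
    have e₂ : (T : ℝ) * (maxCard k (f z) + 2 * (γ * G ^ 2) + 2 * c / β) =
        T * maxCard k (f z) + s * (2 * G ^ 2 + 6 * G ^ 2 / β) := by
      rw [hc, ← hTγ]
      ring
    have e₃ : s * (H / 2 + 2 * G ^ 2 + (2 * A + G * √H + 6 * G ^ 2) / β) =
        s / 2 * H + s * ((2 * A + G * √H) / β) + s * (2 * G ^ 2 + 6 * G ^ 2 / β) := by ring
    linarith
  rw [← Finset.sum_div] at hfinal
  calc 1 / 2 * f xbar S'
      ≤ 1 / (T : ℝ) * ((∑ t ∈ Finset.Icc 1 T, f (xhat t) S') / 2) := by linarith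
    _ ≤ 1 / (T : ℝ) * (T * maxCard k (f z) +
          s * (H / 2 + 2 * G ^ 2 + (2 * A + G * √H + 6 * G ^ 2) / β)) :=
        mul_le_mul_of_nonneg_left hfinal (by positivity)
    _ = _ := by
        rw [← hss]
        field_simp
end

section
/- (Proposition 2(ii).) Let V be a finite set and f : 2^V → [0, ∞) be nonnegative, monotone, and submodular. Let F : ℝ^V → ℝ be its multilinear extension, F(y) = ∑_{S ⊆ V} f(S) ∏_{i ∈ S} y_i ∏_{i ∉ S} (1 − y_i). Then for all y₁, y₂ ∈ [0,1]^V: F(y₂) − 2·F(y₁) ≤ ⟨∇F(y₁), y₂ − y₁⟩. -/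
open scoped RealInnerProductSpace

/-- The probability that the random subset containing each `i` independently with probability `y i`
equals `S`. -/
def subsetWeight {V : Type} [Fintype V] [DecidableEq V] (y : V → ℝ) (S : Finset V) : ℝ :=
  ∏ j, if j ∈ S then y j else 1 - y j

/-- The partial derivative in direction `i` of the multilinear extension of `f`. -/
def multilinearPartial {V : Type} [Fintype V] [DecidableEq V] (f : Finset V → ℝ) (y : V → ℝ)
    (i : V) : ℝ :=
  ∑ S : Finset V, f S * ((∏ j ∈ Finset.univ.erase i, if j ∈ S then y j else 1 - y j) *
    if i ∈ S then 1 else -1)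

section

variable {V : Type} [Fintype V] [DecidableEq V]

theorem subsetWeight_eq_prod_mul_prod_compl (y : V → ℝ) (S : Finset V) :
    subsetWeight y S = (∏ i ∈ S, y i) * ∏ i ∈ Sᶜ, (1 - y i) := by
  rw [subsetWeight, ← Finset.prod_mul_prod_compl S]
  congr 1
  · exact Finset.prod_congr rfl fun i hi => if_pos hi
  · exact Finset.prod_congr rfl fun i hi => if_neg (Finset.mem_compl.mp hi)

theorem subsetWeight_eq_mul_prod_erase (y : V → ℝ) (S : Finset V) (i : V) :
    subsetWeight y S = (if i ∈ S then y i else 1 - y i) *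
      ∏ j ∈ Finset.univ.erase i, if j ∈ S then y j else 1 - y j :=
  (Finset.mul_prod_erase _ _ (Finset.mem_univ i)).symm

theorem subsetWeight_nonneg {y : V → ℝ} (hy : ∀ i, y i ∈ Set.Icc (0 : ℝ) 1) (S : Finset V) :
    0 ≤ subsetWeight y S := by
  refine Finset.prod_nonneg fun i _ => ?_
  split_ifs
  · exact (hy i).1
  · exact sub_nonneg.mpr (hy i).2

theorem sum_subsetWeight (y : V → ℝ) : ∑ S : Finset V, subsetWeight y S = 1 := by
  have h := Finset.prod_add y (fun i => 1 - y i) Finset.univ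
  simp only [add_sub_cancel, Finset.prod_const_one, Finset.powerset_univ] at h
  rw [h]
  refine Finset.sum_congr rfl fun S _ => ?_
  rw [subsetWeight_eq_prod_mul_prod_compl, Finset.compl_eq_univ_sdiff]

theorem sum_finset_eq_sum_erase_insert (i : V) (h : Finset V → ℝ) :
    ∑ S : Finset V, h S = ∑ S ∈ (Finset.univ.erase i).powerset, (h S + h (insert i S)) := by
  rw [Finset.sum_add_distrib, ← Finset.sum_powerset_insert (Finset.notMem_erase i _),
    Finset.insert_erase (Finset.mem_univ i), Finset.powerset_univ]

theorem prod_erase_insert (y : V → ℝ) (i : V) (S : Finset V) :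
    (∏ j ∈ Finset.univ.erase i, if j ∈ insert i S then y j else 1 - y j) =
      ∏ j ∈ Finset.univ.erase i, if j ∈ S then y j else 1 - y j := by
  refine Finset.prod_congr rfl fun j hj => ?_
  simp [Finset.mem_insert, Finset.ne_of_mem_erase hj]

theorem sum_subsetWeight_mul_indicator (y : V → ℝ) (i : V) :
    ∑ S : Finset V, subsetWeight y S * (if i ∈ S then 1 else 0) = y i := by
  conv_rhs => rw [← mul_one (y i), ← sum_subsetWeight y]
  rw [sum_finset_eq_sum_erase_insert i, sum_finset_eq_sum_erase_insert i, Finset.mul_sum]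
  refine Finset.sum_congr rfl fun S hS => ?_
  have hi : i ∉ S := fun h => Finset.notMem_erase i _ (Finset.mem_powerset.mp hS h)
  simp only [subsetWeight_eq_mul_prod_erase y _ i, prod_erase_insert, hi, Finset.mem_insert_self,
    if_true, if_false]
  ring

theorem one_sub_mul_multilinearPartial (f : Finset V → ℝ) (y : V → ℝ) (i : V) :
    (1 - y i) * multilinearPartial f y i =
      ∑ S : Finset V, subsetWeight y S * (f (insert i S) - f S) := by
  rw [multilinearPartial, sum_finset_eq_sum_erase_insert i, sum_finset_eq_sum_erase_insert i,
    Finset.mul_sum]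
  refine Finset.sum_congr rfl fun S hS => ?_
  have hi : i ∉ S := fun h => Finset.notMem_erase i _ (Finset.mem_powerset.mp hS h)
  simp only [subsetWeight_eq_mul_prod_erase y _ i, prod_erase_insert, hi, Finset.mem_insert_self,
    if_true, if_false, Finset.insert_idem]
  ring

theorem mul_multilinearPartial (f : Finset V → ℝ) (y : V → ℝ) (i : V) :
    y i * multilinearPartial f y i =
      ∑ S : Finset V, subsetWeight y S * (f S - f (S.erase i)) := by
  rw [multilinearPartial, sum_finset_eq_sum_erase_insert i, sum_finset_eq_sum_erase_insert i,
    Finset.mul_sum]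
  refine Finset.sum_congr rfl fun S hS => ?_
  have hi : i ∉ S := fun h => Finset.notMem_erase i _ (Finset.mem_powerset.mp hS h)
  simp only [subsetWeight_eq_mul_prod_erase y _ i, prod_erase_insert, hi, Finset.mem_insert_self,
    if_true, if_false, Finset.erase_insert hi, Finset.erase_eq_of_notMem hi]
  ring

theorem hasFDerivAt_sum_mul_subsetWeight (f : Finset V → ℝ) (y : EuclideanSpace ℝ V) :
    HasFDerivAt (fun z : EuclideanSpace ℝ V => ∑ S : Finset V, f S * subsetWeight z S)
      (∑ i, multilinearPartial f y i • (EuclideanSpace.proj i : EuclideanSpace ℝ V →L[ℝ] ℝ)) y := by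
  have hcoord (S : Finset V) (i : V) :
      HasFDerivAt (fun z : EuclideanSpace ℝ V => if i ∈ S then z i else 1 - z i)
        ((if i ∈ S then (1 : ℝ) else -1) •
          (EuclideanSpace.proj i : EuclideanSpace ℝ V →L[ℝ] ℝ)) y := by
    have hproj : HasFDerivAt (fun z : EuclideanSpace ℝ V => z i)
        (EuclideanSpace.proj i : EuclideanSpace ℝ V →L[ℝ] ℝ) y :=
      (EuclideanSpace.proj i : EuclideanSpace ℝ V →L[ℝ] ℝ).hasFDerivAt
    split_ifs
    · simpa using hproj
    · simpa using hproj.const_sub 1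
  have hprod (S : Finset V) := HasFDerivAt.finsetProd (u := Finset.univ) fun i _ => hcoord S i
  have hsum := HasFDerivAt.fun_sum (u := Finset.univ) fun S _ => (hprod S).const_mul (f S)
  refine hsum.congr_fderiv ?_
  simp only [multilinearPartial, Finset.smul_sum, Finset.sum_smul, smul_smul]
  rw [Finset.sum_comm]

end

theorem submodular_union_sub_le_sum {V : Type*} [DecidableEq V] {f : Finset V → ℝ}
    (hmono : ∀ S T : Finset V, S ⊆ T → f S ≤ f T)
    (hsub : ∀ S T : Finset V, f (S ∩ T) + f (S ∪ T) ≤ f S + f T) (R T : Finset V) :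
    f (R ∪ T) - f R ≤ ∑ i ∈ T, (f (insert i R) - f R) := by
  induction T using Finset.induction_on with
  | empty => simp
  | insert a T ha ih =>
    rw [Finset.sum_insert ha]
    have h := hsub (R ∪ T) (insert a R)
    have hinter : f R ≤ f ((R ∪ T) ∩ insert a R) := hmono _ _ (by grind)
    have hunion : (R ∪ T) ∪ insert a R = R ∪ insert a T := by grind
    rw [hunion] at h
    linarith

theorem submodular_sum_le_sub_sdiff {V : Type*} [DecidableEq V] {f : Finset V → ℝ}
    (hsub : ∀ S T : Finset V, f (S ∩ T) + f (S ∪ T) ≤ f S + f T) (R U : Finset V) :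
    ∑ i ∈ U, (f R - f (R.erase i)) ≤ f R - f (R \ U) := by
  induction U using Finset.induction_on with
  | empty => simp
  | insert a U ha ih =>
    rw [Finset.sum_insert ha]
    have h := hsub (R \ U) (R.erase a)
    have hinter : (R \ U) ∩ R.erase a = R \ insert a U := by grind
    have hunion : (R \ U) ∪ R.erase a = R := by grind
    rw [hinter, hunion] at h
    linarith

theorem sub_two_mul_le_sum_indicator_sub_mul_multilinearPartial
    {V : Type} [Fintype V] [DecidableEq V] {f : Finset V → ℝ}
    (hnn : ∀ S : Finset V, 0 ≤ f S)
    (hmono : ∀ S T : Finset V, S ⊆ T → f S ≤ f T)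
    (hsub : ∀ S T : Finset V, f (S ∩ T) + f (S ∪ T) ≤ f S + f T)
    {y : V → ℝ} (hy : ∀ i, y i ∈ Set.Icc (0 : ℝ) 1) (T : Finset V) :
    f T - 2 * ∑ S : Finset V, f S * subsetWeight y S ≤
      ∑ i, ((if i ∈ T then 1 else 0) - y i) * multilinearPartial f y i := by
  have hin : ∑ i ∈ T, ((if i ∈ T then 1 else 0) - y i) * multilinearPartial f y i =
      ∑ S : Finset V, subsetWeight y S * ∑ i ∈ T, (f (insert i S) - f S) := by
    simp_rw [Finset.mul_sum]
    rw [Finset.sum_comm]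
    refine Finset.sum_congr rfl fun i hi => ?_
    rw [if_pos hi, one_sub_mul_multilinearPartial]
  have hout : ∑ i ∈ Tᶜ, ((if i ∈ T then 1 else 0) - y i) * multilinearPartial f y i =
      -∑ S : Finset V, subsetWeight y S * ∑ i ∈ Tᶜ, (f S - f (S.erase i)) := by
    simp_rw [Finset.mul_sum]
    rw [Finset.sum_comm, ← Finset.sum_neg_distrib]
    refine Finset.sum_congr rfl fun i hi => ?_
    rw [if_neg (Finset.mem_compl.mp hi), zero_sub, neg_mul, mul_multilinearPartial]
  rw [← Finset.sum_add_sum_compl T, hin, hout, ← sub_eq_add_neg, ← Finset.sum_sub_distrib]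
  calc f T - 2 * ∑ S : Finset V, f S * subsetWeight y S
      = ∑ S : Finset V, subsetWeight y S * (f T - 2 * f S) := by
        simp_rw [mul_sub, Finset.sum_sub_distrib, ← Finset.sum_mul, sum_subsetWeight, one_mul,
          Finset.mul_sum]
        congr 1
        exact Finset.sum_congr rfl fun S _ => by ring
    _ ≤ _ := by
        refine Finset.sum_le_sum fun S _ => ?_
        rw [← mul_sub]
        refine mul_le_mul_of_nonneg_left ?_ (subsetWeight_nonneg hy S)
        have hgain := submodular_union_sub_le_sum hmono hsub S T
        have hloss := submodular_sum_le_sub_sdiff hsub S Tᶜ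
        have hT := hmono T (S ∪ T) Finset.subset_union_right
        have hpos := hnn (S \ Tᶜ)
        linarith

/-- (Proposition 2(ii).) For a nonnegative, monotone,
submodular `f : 2^V → ℝ` with multilinear extension
`F(y) = ∑_{S ⊆ V} f(S) ∏_{i ∈ S} y_i ∏_{i ∉ S} (1 − y_i)`, one has, for all
`y₁, y₂ ∈ [0,1]^V`, `F(y₂) − 2·F(y₁) ≤ ⟪∇F(y₁), y₂ − y₁⟫`. -/
theorem multilinear_extension_concave_like_inequality
    (V : Type) [Fintype V] [DecidableEq V]
    (f : Finset V → ℝ)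
    (hnn : ∀ S : Finset V, 0 ≤ f S)
    (hmono : ∀ S T : Finset V, S ⊆ T → f S ≤ f T)
    (hsub : ∀ S T : Finset V, f (S ∩ T) + f (S ∪ T) ≤ f S + f T)
    (F : EuclideanSpace ℝ V → ℝ)
    (hF : ∀ y : EuclideanSpace ℝ V,
      F y = ∑ S : Finset V, f S * ((∏ i ∈ S, y i) * ∏ i ∈ Sᶜ, (1 - y i)))
    (y₁ y₂ : EuclideanSpace ℝ V)
    (hy₁ : ∀ i, y₁ i ∈ Set.Icc (0 : ℝ) 1)
    (hy₂ : ∀ i, y₂ i ∈ Set.Icc (0 : ℝ) 1) :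
    F y₂ - 2 * F y₁ ≤ ⟪gradient F y₁, y₂ - y₁⟫ := by
  have hF' : F = fun z : EuclideanSpace ℝ V => ∑ S : Finset V, f S * subsetWeight z S := by
    funext z
    simp_rw [hF, subsetWeight_eq_prod_mul_prod_compl]
  have hderiv := hasFDerivAt_sum_mul_subsetWeight f y₁
  rw [← hF'] at hderiv
  have hinner : ⟪gradient F y₁, y₂ - y₁⟫ =
      ∑ i, (y₂ i - y₁ i) * multilinearPartial f y₁ i := by
    rw [gradient, InnerProductSpace.toDual_symm_apply, hderiv.fderiv]
    simp [mul_comm]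
  rw [hinner, hF']
  dsimp only
  set c := ∑ S : Finset V, f S * subsetWeight y₁ S
  calc ∑ S : Finset V, f S * subsetWeight y₂ S - 2 * c
      = ∑ T : Finset V, subsetWeight y₂ T * (f T - 2 * c) := by
        simp_rw [mul_sub, Finset.sum_sub_distrib, ← Finset.sum_mul, sum_subsetWeight, one_mul,
          mul_comm]
    _ ≤ ∑ T : Finset V, subsetWeight y₂ T *
          ∑ i, ((if i ∈ T then 1 else 0) - y₁ i) * multilinearPartial f y₁ i :=
        Finset.sum_le_sum fun T _ => mul_le_mul_of_nonneg_left
          (sub_two_mul_le_sum_indicator_sub_mul_multilinearPartial hnn hmono hsub hy₁ T)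
          (subsetWeight_nonneg hy₂ T)
    _ = ∑ i, (y₂ i - y₁ i) * multilinearPartial f y₁ i := by
        simp_rw [Finset.mul_sum]
        rw [Finset.sum_comm]
        refine Finset.sum_congr rfl fun i _ => ?_
        simp_rw [← mul_assoc, ← Finset.sum_mul, mul_sub, Finset.sum_sub_distrib,
          ← Finset.sum_mul, sum_subsetWeight, sum_subsetWeight_mul_indicator, one_mul]
end

section
/- (Max–min guarantee of Gradient Replacement-Greedy, Theorem 8.) In addition to the setting of the Gradient Replacement-Greedy convergence theorem—k ≥ 2; X ⊆ ℝ^d nonempty closed convex with x₁ ∈ X and ‖x − x₁‖² ≤ H on X; f : ℝ^d × 2^V → [0, ∞) with each f(·, S) convex differentiable, ‖∇ₓ f(x, S)‖ ≤ M, ∇ₓ f(·, S) L-Lipschitz, and f(x₁, S) ≤ A for all |S| ≤ k; √T ≥ L, γ = 1/√T; for all 1 ≤ t ≤ T: |S_t| ≤ k, x_{t+1} = π_X(x_t − γ ∇ₓ f(x_t, S_t)), and f(x_{t+1}, S_{t+1}) − f(x_{t+1}, S_t) ≥ (1/k)( f(x_{t+1}, S) − 2 f(x_{t+1}, S_t)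 ) for all |S| ≤ k—assume moreover that f(x, ·) is monotone for every x, i.e. f(x, S) ≤ f(x, T') whenever S ⊆ T' ⊆ V. Then (1/2) · max_{|S| ≤ k} min_{x ∈ X} f(x, S) ≤ min_{x ∈ X} f(x, S₁ ∪ S₂ ∪ ⋯ ∪ S_T) + H/(2√T) + A/(2T(1 − e^{−2/k})) + M²(1 + k)/√T. -/
open scoped RealInnerProductSpace

/-- First-order convexity inequality for a convex function on an inner product space. -/
theorem ConvexOn.inner_gradient_le_sub {E : Type*} [NormedAddCommGroup E]
    [InnerProductSpace ℝ E] [CompleteSpace E] {g : E → ℝ} {v a : E}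
    (hg : ConvexOn ℝ Set.univ g) (hv : HasGradientAt g v a) (b : E) :
    ⟪v, b - a⟫ ≤ g b - g a := by
  have hline : ConvexOn ℝ Set.univ (g ∘ AffineMap.lineMap (k := ℝ) a b) := by
    simpa using hg.comp_affineMap (AffineMap.lineMap (k := ℝ) a b)
  have hd : HasDerivAt (g ∘ AffineMap.lineMap (k := ℝ) a b) ⟪v, b - a⟫ 0 := by
    have hv' : HasFDerivAt g (InnerProductSpace.toDual ℝ E v)
        (AffineMap.lineMap (k := ℝ) a b 0) := by
      simpa using hv.hasFDerivAt
    simpa using hv'.comp_hasDerivAt (0 : ℝ) AffineMap.hasDerivAt_lineMap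
  simpa [slope_def_field] using
    hline.le_slope_of_hasDerivAt (Set.mem_univ 0) (Set.mem_univ 1) one_pos hd

/-- The increment of a convex function is controlled by the norm of the gradient at the endpoint. -/
theorem ConvexOn.sub_le_mul_norm_of_hasGradientAt {E : Type*} [NormedAddCommGroup E]
    [InnerProductSpace ℝ E] [CompleteSpace E] {g : E → ℝ} {v b : E} {M : ℝ}
    (hg : ConvexOn ℝ Set.univ g) (hv : HasGradientAt g v b) (hM : ‖v‖ ≤ M) (a : E) :
    g b - g a ≤ M * ‖b - a‖ := by
  have h := hg.inner_gradient_le_sub hv a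
  have h' : -⟪v, a - b⟫ ≤ ‖v‖ * ‖b - a‖ := by
    rw [← inner_neg_right, neg_sub]
    exact real_inner_le_norm v (b - a)
  have := mul_le_mul_of_nonneg_right hM (norm_nonneg (b - a))
  linarith

/-- A projected gradient step moves by at most the length of the unprojected step. -/
theorem norm_sub_le_of_inner_step_sub_nonpos {E : Type*} [NormedAddCommGroup E]
    [InnerProductSpace ℝ E] {a b v : E} {γ M : ℝ} (hγ : 0 ≤ γ) (hM : ‖v‖ ≤ M)
    (h : ⟪(a - γ • v) - b, a - b⟫ ≤ 0) : ‖b - a‖ ≤ γ * M := by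
  have hsplit : ⟪(a - γ • v) - b, a - b⟫ = ‖a - b‖ ^ 2 - γ * ⟪v, a - b⟫ := by
    rw [sub_right_comm, inner_sub_left, real_inner_self_eq_norm_sq, real_inner_smul_left]
  have hcs : γ * ⟪v, a - b⟫ ≤ γ * M * ‖a - b‖ := by
    rw [mul_assoc]
    gcongr
    exact (real_inner_le_norm v (a - b)).trans (by gcongr)
  have hM0 : 0 ≤ γ * M := mul_nonneg hγ ((norm_nonneg v).trans hM)
  rw [norm_sub_rev]
  by_contra! hlt
  nlinarith [norm_nonneg (a - b)]

/-- The basic one-step estimate for projected gradient descent, with step size `γ` and the function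
value taken at the new iterate. -/
theorem ConvexOn.projected_gradient_step_le {E : Type*} [NormedAddCommGroup E]
    [InnerProductSpace ℝ E] [CompleteSpace E] {g : E → ℝ} {v v' a b z : E} {γ M : ℝ}
    (hg : ConvexOn ℝ Set.univ g) (hv : HasGradientAt g v a) (hv' : HasGradientAt g v' b)
    (hγ : 0 < γ) (hM : ‖v‖ ≤ M) (hM' : ‖v'‖ ≤ M)
    (hz : ⟪(a - γ • v) - b, z - b⟫ ≤ 0) (hab : ‖b - a‖ ≤ γ * M) :
    g b ≤ g z + (‖a - z‖ ^ 2 - ‖b - z‖ ^ 2) / (2 * γ) + 2 * (γ * M ^ 2) := by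
  have hM0 : 0 ≤ M := (norm_nonneg v).trans hM
  have h₁ := hg.sub_le_mul_norm_of_hasGradientAt hv' hM' a
  have h₂ := hg.inner_gradient_le_sub hv z
  have h₃ : ⟪v, a - b⟫ ≤ M * ‖b - a‖ := by
    rw [norm_sub_rev b a]
    exact (real_inner_le_norm v (a - b)).trans (by gcongr)
  have h₄ : M * ‖b - a‖ ≤ M * (γ * M) := by gcongr
  have hsplit : ⟪v, z - a⟫ = ⟪v, z - b⟫ - ⟪v, a - b⟫ := by
    rw [← inner_sub_right, sub_sub_sub_cancel_right]
  have hexp : ⟪(a - γ • v) - b, z - b⟫ = ⟪a - b, z - b⟫ - γ * ⟪v, z - b⟫ := by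
    rw [sub_right_comm, inner_sub_left, real_inner_smul_left]
  have hpol : ‖a - z‖ ^ 2 = ‖a - b‖ ^ 2 - 2 * ⟪a - b, z - b⟫ + ‖b - z‖ ^ 2 := by
    rw [← sub_sub_sub_cancel_right a z b, norm_sub_sq_real, norm_sub_rev z b]
  have h₅ : -⟪v, z - b⟫ ≤ (‖a - z‖ ^ 2 - ‖b - z‖ ^ 2) / (2 * γ) := by
    rw [le_div_iff₀ (by positivity)]
    nlinarith [sq_nonneg ‖a - b‖]
  linarith

/-- Summing a perturbed contraction `δ (n + 1) ≤ (1 - q) δ n + ε`. -/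
theorem mul_sum_range_le_of_contraction {δ : ℕ → ℝ} {q C ε : ℝ} {T : ℕ} (hq : 0 < q)
    (hq' : q ≤ 1) (hC : 0 ≤ C) (hε : 0 ≤ ε) (h0 : δ 0 ≤ C)
    (hstep : ∀ n, n + 1 < T → δ (n + 1) ≤ (1 - q) * δ n + ε) :
    q * ∑ n ∈ Finset.range T, δ n ≤ C + T * ε := by
  have hr : 0 ≤ 1 - q := sub_nonneg.2 hq'
  have hδ : ∀ n, n < T → q * δ n ≤ q * ((1 - q) ^ n * C) + ε := by
    intro n
    induction n with
    | zero => intro _; simp only [pow_zero, one_mul]; nlinarith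
    | succ n ih =>
      intro hn
      have h₁ := mul_le_mul_of_nonneg_left (ih (by omega)) hr
      have h₂ := mul_le_mul_of_nonneg_left (hstep n hn) hq.le
      calc q * δ (n + 1) ≤ q * ((1 - q) * δ n + ε) := h₂
        _ = (1 - q) * (q * δ n) + q * ε := by ring
        _ ≤ (1 - q) * (q * ((1 - q) ^ n * C) + ε) + q * ε := by gcongr
        _ = q * ((1 - q) ^ (n + 1) * C) + ε := by ring
  have hgeom := mul_neg_geom_sum (1 - q) T
  rw [sub_sub_cancel] at hgeom
  calc q * ∑ n ∈ Finset.range T, δ n = ∑ n ∈ Finset.range T, q * δ n := Finset.mul_sum ..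
    _ ≤ ∑ n ∈ Finset.range T, (q * ((1 - q) ^ n * C) + ε) :=
        Finset.sum_le_sum fun n hn => hδ n (Finset.mem_range.1 hn)
    _ = (q * ∑ n ∈ Finset.range T, (1 - q) ^ n) * C + T * ε := by
        rw [Finset.sum_add_distrib, ← Finset.mul_sum, ← Finset.sum_mul]
        simp [mul_assoc]
    _ = (1 - (1 - q) ^ T) * C + T * ε := by rw [hgeom]
    _ ≤ C + T * ε := by nlinarith [mul_nonneg (pow_nonneg hr T) hC]

/-- (Max–min guarantee of Gradient Replacement-Greedy.) In
the setting of the Gradient Replacement-Greedy convergence theorem, and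
assuming moreover that `f(x,·)` is monotone for every `x`, the union
`S₁ ∪ ⋯ ∪ S_T` satisfies
`(1/2)·max_{|S|≤k} min_{x∈X} f(x,S) ≤ min_{x∈X} f(x, S₁ ∪ ⋯ ∪ S_T)
  + H/(2√T) + A/(2T(1 − e^{−2/k})) + M²(1+k)/√T`. -/
theorem gradient_replacement_greedy_maxmin_guarantee
    {d : ℕ} (V : Type) [Fintype V] [DecidableEq V] (k : ℕ) (hk : 2 ≤ k)
    (X : Set (EuclideanSpace ℝ (Fin d))) (hXne : X.Nonempty)
    (hXcl : IsClosed X) (hXconv : Convex ℝ X)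
    (H M L A : ℝ) (hH : 0 < H) (hA : 0 ≤ A)
    (f : EuclideanSpace ℝ (Fin d) → Finset V → ℝ)
    (gradf : EuclideanSpace ℝ (Fin d) → Finset V → EuclideanSpace ℝ (Fin d))
    (hf_nonneg : ∀ x S, 0 ≤ f x S)
    (hconv : ∀ S : Finset V, S.card ≤ k → ConvexOn ℝ Set.univ (fun x => f x S))
    (hgrad : ∀ S : Finset V, S.card ≤ k →
      ∀ x, HasGradientAt (fun y => f y S) (gradf x S) x)
    (hM : ∀ x, ∀ S : Finset V, S.card ≤ k → ‖gradf x S‖ ≤ M)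
    (hL : ∀ S : Finset V, S.card ≤ k →
      ∀ x x', ‖gradf x' S - gradf x S‖ ≤ L * ‖x' - x‖)
    (hfmono : ∀ x, ∀ S T' : Finset V, S ⊆ T' → f x S ≤ f x T')
    (T : ℕ) (hT : 0 < T) (hTL : L ≤ Real.sqrt T)
    (γ : ℝ) (hγ : γ = 1 / Real.sqrt T)
    (x : ℕ → EuclideanSpace ℝ (Fin d)) (S : ℕ → Finset V)
    (hx1 : x 1 ∈ X)
    (hbound : ∀ z ∈ X, ‖z - x 1‖ ^ 2 ≤ H)
    (hA_bound : ∀ S' : Finset V, S'.card ≤ k → f (x 1) S' ≤ A)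
    (hcard : ∀ t, 1 ≤ t → t ≤ T + 1 → (S t).card ≤ k)
    (hproj_mem : ∀ t, 1 ≤ t → t ≤ T → x (t + 1) ∈ X)
    (hproj : ∀ t, 1 ≤ t → t ≤ T → ∀ w ∈ X,
      ⟪(x t - γ • gradf (x t) (S t)) - x (t + 1), w - x (t + 1)⟫ ≤ 0)
    (hrep : ∀ t, 1 ≤ t → t ≤ T → ∀ S' : Finset V, S'.card ≤ k →
      (1 / (k : ℝ)) * (f (x (t + 1)) S' - 2 * f (x (t + 1)) (S t)) ≤
        f (x (t + 1)) (S (t + 1)) - f (x (t + 1)) (S t)) :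
    (1 / 2) * maxCard k (fun S' => sInf ((fun z => f z S') '' X)) ≤
      sInf ((fun z => f z ((Finset.Icc 1 T).biUnion S)) '' X)
        + H / (2 * Real.sqrt T)
        + A / (2 * T * (1 - Real.exp (-2 / (k : ℝ))))
        + M ^ 2 * (1 + k) / Real.sqrt T := by
  have hM0 : 0 ≤ M := (norm_nonneg _).trans (hM (x 1) ∅ (by simp))
  have hTpos : (0 : ℝ) < T := by exact_mod_cast hT
  have hs : 0 < √(T : ℝ) := Real.sqrt_pos.2 hTpos
  have hss : √(T : ℝ) * √(T : ℝ) = T := Real.mul_self_sqrt hTpos.le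
  have hγ0 : 0 < γ := by rw [hγ]; positivity
  have hk2 : (2 : ℝ) ≤ k := by exact_mod_cast hk
  have hk0 : (0 : ℝ) < k := by linarith
  have hxX : ∀ n, n ≤ T → x (n + 1) ∈ X := by
    rintro (_ | n) hn
    · exact hx1
    · exact hproj_mem (n + 1) (by omega) hn
  have hmove : ∀ n, n < T → ‖x (n + 2) - x (n + 1)‖ ≤ γ * M := fun n hn =>
    norm_sub_le_of_inner_step_sub_nonpos hγ0.le (hM _ _ (hcard (n + 1) (by omega) (by omega)))
      (hproj (n + 1) (by omega) (by omega) _ (hxX n hn.le))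
  obtain ⟨S₀, hS₀, hmax⟩ := Finset.exists_mem_eq_sup'
    (s := (Finset.univ : Finset (Finset V)).filter (fun S => S.card ≤ k)) ⟨∅, by simp⟩
    (fun S' => sInf ((fun z => f z S') '' X))
  replace hS₀ : S₀.card ≤ k := by simpa using hS₀
  change maxCard k _ = _ at hmax
  rw [hmax]
  set φ : ℝ := sInf ((fun z => f z S₀) '' X)
  have hφle : ∀ z ∈ X, φ ≤ f z S₀ := fun z hz =>
    csInf_le ⟨0, by rintro _ ⟨w, -, rfl⟩; exact hf_nonneg w S₀⟩ ⟨z, hz, rfl⟩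
  set a : ℕ → ℝ := fun n => f (x (n + 2)) (S (n + 1))
  have hgreedy : (2 / (k : ℝ)) * ∑ n ∈ Finset.range T, (φ / 2 - a n) ≤
      A / 2 + T * (γ * M ^ 2) := by
    refine mul_sum_range_le_of_contraction (by positivity) ((div_le_one hk0).2 hk2)
      (by positivity) (by positivity) ?_ ?_
    · have h₁ := hφle _ hx1
      have h₂ := hA_bound S₀ hS₀
      have h₃ : 0 ≤ a 0 := hf_nonneg _ _
      linarith
    · intro n hn
      have hrep' := hrep (n + 1) (by omega) (by omega) S₀ hS₀
      have hφn := hφle _ (hxX (n + 1) (by omega))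
      have hS := hcard (n + 2) (by omega) (by omega)
      have hlip : f (x (n + 2)) (S (n + 2)) - a (n + 1) ≤ M * ‖x (n + 2) - x (n + 3)‖ :=
        (hconv _ hS).sub_le_mul_norm_of_hasGradientAt (hgrad _ hS _) (hM _ _ hS) (x (n + 3))
      rw [norm_sub_rev] at hlip
      have hmv := mul_le_mul_of_nonneg_left (hmove (n + 1) hn) hM0
      have hgain : (1 / (k : ℝ)) * (φ - 2 * a n) ≤
          (1 / (k : ℝ)) * (f (x (n + 2)) S₀ - 2 * a n) := by
        gcongr
      have hring : (1 - 2 / (k : ℝ)) * (φ / 2 - a n) =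
          φ / 2 - a n - (1 / (k : ℝ)) * (φ - 2 * a n) := by ring
      rw [hring]
      have hb : (1 / (k : ℝ)) * (f (x (n + 2)) S₀ - 2 * a n) ≤
          f (x (n + 2)) (S (n + 2)) - a n := hrep'
      have hmv' : M * ‖x (n + 3) - x (n + 2)‖ ≤ M * (γ * M) := hmv
      linarith
  have hdescent : ∀ z ∈ X, ∑ n ∈ Finset.range T, a n ≤
      T * f z ((Finset.Icc 1 T).biUnion S) + H / (2 * γ) + T * (2 * (γ * M ^ 2)) := by
    intro z hz
    calc ∑ n ∈ Finset.range T, a n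
        ≤ ∑ n ∈ Finset.range T, (f z ((Finset.Icc 1 T).biUnion S) +
            (‖x (n + 1) - z‖ ^ 2 - ‖x (n + 1 + 1) - z‖ ^ 2) / (2 * γ) + 2 * (γ * M ^ 2)) := by
          refine Finset.sum_le_sum fun n hn => ?_
          have hn : n < T := Finset.mem_range.1 hn
          have hS := hcard (n + 1) (by omega) (by omega)
          have hstep := (hconv _ hS).projected_gradient_step_le (hgrad _ hS (x (n + 1)))
            (hgrad _ hS (x (n + 2))) hγ0 (hM _ _ hS) (hM _ _ hS)
            (hproj (n + 1) (by omega) (by omega) z hz) (hmove n hn)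
          have hU := hfmono z (S (n + 1)) ((Finset.Icc 1 T).biUnion S)
            (Finset.subset_biUnion_of_mem S (Finset.mem_Icc.2 ⟨by omega, by omega⟩))
          exact hstep.trans (by gcongr)
      _ = T * f z ((Finset.Icc 1 T).biUnion S) +
            (‖x 1 - z‖ ^ 2 - ‖x (T + 1) - z‖ ^ 2) / (2 * γ) + T * (2 * (γ * M ^ 2)) := by
          rw [Finset.sum_add_distrib, Finset.sum_add_distrib, ← Finset.sum_div,
            Finset.sum_range_sub' (fun n => ‖x (n + 1) - z‖ ^ 2)]
          simp
      _ ≤ _ := by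
          have h₁ := hbound z hz
          rw [norm_sub_rev] at h₁
          have h₂ := sq_nonneg ‖x (T + 1) - z‖
          gcongr
          linarith
  have hexp0 : 0 < 1 - Real.exp (-2 / (k : ℝ)) := by
    rw [sub_pos, Real.exp_lt_one_iff]
    exact div_neg_of_neg_of_pos (by norm_num) hk0
  have hexp : 1 - Real.exp (-2 / (k : ℝ)) ≤ 2 / k := by
    have := Real.add_one_le_exp (-2 / (k : ℝ))
    rw [neg_div] at this ⊢
    linarith
  have hAterm : k * A / (4 * T) ≤ A / (2 * T * (1 - Real.exp (-2 / (k : ℝ)))) := by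
    calc k * A / (4 * T) = A / (2 * T * (2 / k)) := by field_simp; norm_num
      _ ≤ _ := by gcongr
  have hgreedy' : T * (φ / 2) - ∑ n ∈ Finset.range T, a n ≤
      k / 2 * (A / 2 + T * (γ * M ^ 2)) := by
    have h := mul_le_mul_of_nonneg_left hgreedy (by positivity : (0 : ℝ) ≤ k / 2)
    rw [← mul_assoc, div_mul_div_cancel₀ two_ne_zero, div_self hk0.ne', one_mul,
      Finset.sum_sub_distrib] at h
    simpa using h
  have hkey : ∀ z ∈ X, φ / 2 - H / (2 * √T) - A / (2 * T * (1 - Real.exp (-2 / (k : ℝ)))) -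
      M ^ 2 * (1 + k) / √T ≤ f z ((Finset.Icc 1 T).biUnion S) := by
    intro z hz
    have h := hdescent z hz
    have hHs : H / (2 * γ) = T * (H / (2 * √T)) := by
      rw [hγ]; field_simp; linarith [hss]
    have hMs : M ^ 2 * (1 + k) / √T = (1 + k) * (γ * M ^ 2) := by rw [hγ]; ring
    have hAs : k / 2 * (A / 2) = T * (k * A / (4 * T)) := by field_simp; ring
    have hslack : (2 + k / 2) * (γ * M ^ 2) ≤ (1 + k) * (γ * M ^ 2) :=
      mul_le_mul_of_nonneg_right (by linarith) (by positivity)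
    have hmain : T * (φ / 2) ≤ T * (f z ((Finset.Icc 1 T).biUnion S) + H / (2 * √T) +
        k * A / (4 * T) + (2 + k / 2) * (γ * M ^ 2)) := by
      linarith
    have := le_of_mul_le_mul_left hmain hTpos
    linarith
  have hinf := le_csInf (hXne.image _) (Set.forall_mem_image.2 hkey)
  linarith
end
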